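/- Let B ∈ V(A'(T)) and let c, d ∈ B with d ≤ c and e_i(m̄,c) = e_i(m̄,d) for all i ∈ {0,1,2} and all m̄ ∈ B² ∪ B. Suppose there are unary polynomials f1(x), f2(x) of B with r = f1(c), t = f1(d) = f2(c), and s = f2(d). Then r = t or t = s. (Consequently, under these hypotheses every decreasing Maltsev chain witnessing membership in Cg^B(c,d) has length at most 1.) -/

import Mathlib

open FirstOrder

namespace McKenzie

/-- A Turing machine instruction `(s, r, w, d, t)`: "in state `s` reading `r`,
write `w`, move in direction `d` (`true` = right, `false` = left), enter state `t`". -/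
structure Instr (n : ℕ) where
  s : Fin (n + 1)
  r : Bool
  w : Bool
  d : Bool
  t : Fin (n + 1)

/-- A Turing machine: a finite list of instructions on states `μ0, …, μn`
(represented by `Fin (states+1)`), where `μ0` is the halting state (carrying no
instructions) and `μ1` is the initial state. -/
structure TM where
  states : ℕ
  instr : List (Instr states)
  halt_no_instr : ∀ i ∈ instr, i.s ≠ 0

/-- A configuration of a Turing machine: a tape, a head position and a state. -/
structure Cfg (T : TM) where
  tape : ℤ → Bool
  head : ℤ
  state : Fin (T.states + 1)

/-- One computation step of the machine (using the first applicable instruction). -/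
def TM.step (T : TM) (Q : Cfg T) : Option (Cfg T) :=
  match T.instr.find? (fun i => decide (i.s = Q.state ∧ i.r = Q.tape Q.head)) with
  | none => none
  | some i =>
      some ⟨Function.update Q.tape Q.head i.w,
        if i.d then Q.head + 1 else Q.head - 1, i.t⟩

/-- The configuration after `n` steps when started in state `μ1` on the blank tape. -/
def TM.run (T : TM) : ℕ → Option (Cfg T)
  | 0 => some ⟨fun _ => false, 0, 1⟩
  | n + 1 => (T.run n).bind T.step

/-- `T` halts (started in the initial state `μ1` on the empty, all-zero, tape). -/
def TM.Halts (T : TM) : Prop := ∃ (n : ℕ) (Q : Cfg T), T.run n = some Q ∧ Q.state = 0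

/-- The universe of the algebra `A'(T)`:
`0`, `U = {1,2,H}`, `W = {C, D, ∂C, ∂D}`, and
`V = {C_ir^s, D_ir^s, M_i^r}` together with their barred versions. -/
inductive El (T : TM) : Type
  | zero
  | one
  | two
  | H
  | C (bar : Bool)
  | D (bar : Bool)
  | Cv (bar : Bool) (i : Fin (T.states + 1)) (r s : Bool)
  | Dv (bar : Bool) (i : Fin (T.states + 1)) (r s : Bool)
  | Mv (bar : Bool) (i : Fin (T.states + 1)) (r : Bool)
  deriving DecidableEq

namespace El

variable {T : TM}

/-- The bar involution `∂`, defined (only) on `V ∪ W`. -/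
def bar : El T → Option (El T)
  | C b => some (C (!b))
  | D b => some (D (!b))
  | Cv b i r s => some (Cv (!b) i r s)
  | Dv b i r s => some (Dv (!b) i r s)
  | Mv b i r => some (Mv (!b) i r)
  | _ => none

/-- The flat (height 1) semilattice meet with bottom element `0`. -/
def meet (x y : El T) : El T := if x = y then x else zero

/-- Join in the flat semilattice, for comparable elements. -/
def fjoin (x y : El T) : El T := if x = zero then y else x

/-- The nonassociative multiplication: `2·D = H·C = D`, `1·C = C`,
`2·∂D = H·∂C = ∂D`, `1·∂C = ∂C`, and `0` otherwise. -/
def mul : El T → El T → El T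
  | two, D b => D b
  | H, C b => D b
  | one, C b => C b
  | _, _ => zero

/-- `J(x,y,z) = (x ∧ ∂y ∧ z) ∨ (x ∧ y)`. -/
def opJ (x y z : El T) : El T :=
  if x = y then x else if bar y = some x then meet x z else zero

/-- `J'(x,y,z) = (x ∧ y ∧ z) ∨ (x ∧ ∂y)`. -/
def opJ' (x y z : El T) : El T :=
  if x = y then meet x z else if bar y = some x then x else zero

/-- `K(x,y,z) = (∂x ∧ y) ∨ (∂x ∧ ∂y ∧ z) ∨ (x ∧ y ∧ z)`. -/
def opK (x y z : El T) : El T :=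
  if bar y = some x then y
  else if x = y ∧ bar z = some x then z
  else meet x (meet y z)

/-- `(x ∧ y) ∨ (x ∧ z)`. -/
def sCore (x y z : El T) : El T := fjoin (meet x y) (meet x z)

/-- Membership in `V₀` (the elements of `V` with state index `0`). -/
def isV0 : El T → Bool
  | Cv _ i _ _ => decide (i = 0)
  | Dv _ i _ _ => decide (i = 0)
  | Mv _ i _ => decide (i = 0)
  | _ => false

/-- `S₀(u,x,y,z) = (x∧y) ∨ (x∧z)` if `u ∈ V₀`, else `0`. -/
def opS0 (u x y z : El T) : El T := if isV0 u then sCore x y z else zero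

/-- `S₁(u,x,y,z) = (x∧y) ∨ (x∧z)` if `u ∈ {1,2}`, else `0`. -/
def opS1 (u x y z : El T) : El T := if u = one ∨ u = two then sCore x y z else zero

/-- `S₂(u,v,x,y,z) = (x∧y) ∨ (x∧z)` if `u = ∂v ∈ V ∪ W`, else `0`. -/
def opS2 (u v x y z : El T) : El T := if bar v = some u then sCore x y z else zero

/-- The operation `T(w,x,y,z)`. -/
def opT (w x y z : El T) : El T :=
  if mul w x = mul y z then
    if w = y ∧ x = z then mul w x
    else if mul w x ≠ zero then (bar (mul w x)).getD zero else zero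
  else zero

/-- `I(1) = C₁₀⁰`, `I(H) = M₁⁰`, `I(2) = D₁₀⁰`, and `0` otherwise. -/
def opI : El T → El T
  | one => Cv false 1 false false
  | H => Mv false 1 false
  | two => Dv false 1 false false
  | _ => zero

/-- The left-moving machine operation `L_{irt}` attached to an instruction
`(μ_i, r, s, L, μ_j)` and `t ∈ {0,1}`. -/
def opL (ins : Instr T.states) (t : Bool) : El T → El T → El T → El T
  | one, one, Cv b i r s' => if i = ins.s ∧ r = ins.r then Cv b ins.t t s' else zero
  | H, one, Cv b i r s' => if i = ins.s ∧ r = ins.r ∧ s' = t then Mv b ins.t t else zero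
  | two, H, Mv b i r => if i = ins.s ∧ r = ins.r then Dv b ins.t t ins.w else zero
  | two, two, Dv b i r s' => if i = ins.s ∧ r = ins.r then Dv b ins.t t s' else zero
  | _, _, _ => zero

/-- The right-moving machine operation `R_{irt}` attached to an instruction
`(μ_i, r, s, R, μ_j)` and `t ∈ {0,1}`. -/
def opR (ins : Instr T.states) (t : Bool) : El T → El T → El T → El T
  | one, one, Cv b i r s' => if i = ins.s ∧ r = ins.r then Cv b ins.t t s' else zero
  | H, one, Mv b i r => if i = ins.s ∧ r = ins.r then Cv b ins.t t ins.w else zero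
  | two, H, Dv b i r s' => if i = ins.s ∧ r = ins.r ∧ s' = t then Mv b ins.t t else zero
  | two, two, Dv b i r s' => if i = ins.s ∧ r = ins.r then Dv b ins.t t s' else zero
  | _, _, _ => zero

/-- The machine operation (from `𝓛 ∪ 𝓡`) attached to an instruction. -/
def mach (ins : Instr T.states) (t : Bool) (x y u : El T) : El T :=
  if ins.d then opR ins t x y u else opL ins t x y u

/-- The relation `≺` on `{1,2,H}`. -/
def prec : El T → El T → Bool
  | two, two => true
  | two, H => true
  | one, one => true
  | _, _ => false

/-- The operation `U_F^1`. -/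
def opU1 (F : El T → El T → El T → El T) (x y z u : El T) : El T :=
  if prec x z then
    if y = z then F x y u
    else if F x y u ≠ zero then (bar (F x y u)).getD zero else zero
  else zero

/-- The operation `U_F^0`. -/
def opU0 (F : El T → El T → El T → El T) (x y z u : El T) : El T :=
  if prec x z then
    if x = y then F y z u
    else if F y z u ≠ zero then (bar (F y z u)).getD zero else zero
  else zero

end El

/-- The unary operation symbols of `A'(T)`. -/
inductive Ops1 : Type
  | I

/-- The binary operation symbols of `A'(T)`. -/
inductive Ops2 : Type
  | meet
  | mul

/-- The ternary operation symbols of `A'(T)`: `J`, `J'`, `K` and the machine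
operations from `𝓛 ∪ 𝓡` (one for each instruction and each `t ∈ {0,1}`). -/
inductive Ops3 (T : TM) : Type
  | J
  | J'
  | K
  | mach (k : Fin T.instr.length) (t : Bool)

/-- The 4-ary operation symbols of `A'(T)`: `S₀`, `S₁`, `T` and the operations
`U_F^1, U_F^0` for `F ∈ 𝓛 ∪ 𝓡`. -/
inductive Ops4 (T : TM) : Type
  | S0
  | S1
  | T
  | u1 (k : Fin T.instr.length) (t : Bool)
  | u0 (k : Fin T.instr.length) (t : Bool)

/-- The 5-ary operation symbols of `A'(T)`: `S₂`. -/
inductive Ops5 : Type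
  | S2

/-- The signature (similarity type) of the algebra `A'(T)`; the constant symbol
(of arity 0) denotes the bottom element `0`. -/
def Sig (T : TM) : FirstOrder.Language.{0, 0} where
  Functions n :=
    match n with
    | 0 => PUnit
    | 1 => Ops1
    | 2 => Ops2
    | 3 => Ops3 T
    | 4 => Ops4 T
    | 5 => Ops5
    | _ => PEmpty
  Relations _ := PEmpty


/-- The constant symbol `0` as an element of the signature. -/
def fn0 (T : TM) : (Sig T).Functions 0 := PUnit.unit
/-- Unary operation symbols as elements of the signature. -/
def fn1 (T : TM) (o : Ops1) : (Sig T).Functions 1 := o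
/-- Binary operation symbols as elements of the signature. -/
def fn2 (T : TM) (o : Ops2) : (Sig T).Functions 2 := o
/-- Ternary operation symbols as elements of the signature. -/
def fn3 (T : TM) (o : Ops3 T) : (Sig T).Functions 3 := o
/-- 4-ary operation symbols as elements of the signature. -/
def fn4 (T : TM) (o : Ops4 T) : (Sig T).Functions 4 := o
/-- 5-ary operation symbols as elements of the signature. -/
def fn5 (T : TM) (o : Ops5) : (Sig T).Functions 5 := o

/-- The algebra `A'(T)`: the interpretation of the signature `Sig T` on `El T`. -/
instance elStructure (T : TM) : (Sig T).Structure (El T) where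
  funMap {n} f v :=
    match n, f, v with
    | 0, _, _ => El.zero
    | 1, Ops1.I, v => El.opI (v 0)
    | 2, Ops2.meet, v => El.meet (v 0) (v 1)
    | 2, Ops2.mul, v => El.mul (v 0) (v 1)
    | 3, Ops3.J, v => El.opJ (v 0) (v 1) (v 2)
    | 3, Ops3.J', v => El.opJ' (v 0) (v 1) (v 2)
    | 3, Ops3.K, v => El.opK (v 0) (v 1) (v 2)
    | 3, Ops3.mach k t, v => El.mach (T.instr.get k) t (v 0) (v 1) (v 2)
    | 4, Ops4.S0, v => El.opS0 (v 0) (v 1) (v 2) (v 3)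
    | 4, Ops4.S1, v => El.opS1 (v 0) (v 1) (v 2) (v 3)
    | 4, Ops4.T, v => El.opT (v 0) (v 1) (v 2) (v 3)
    | 4, Ops4.u1 k t, v => El.opU1 (El.mach (T.instr.get k) t) (v 0) (v 1) (v 2) (v 3)
    | 4, Ops4.u0 k t, v => El.opU0 (El.mach (T.instr.get k) t) (v 0) (v 1) (v 2) (v 3)
    | 5, Ops5.S2, v => El.opS2 (v 0) (v 1) (v 2) (v 3) (v 4)
    | _ + 6, f, _ => f.elim
  RelMap {n} r _ := r.elim

/-- The product algebra `A'(T)^ι`. -/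
instance piStructure (T : TM) (ι : Type*) : (Sig T).Structure (ι → El T) where
  funMap f v l := Language.Structure.funMap f fun i => v i l
  RelMap r _ := r.elim

open Language

/-- A congruence of an algebra: an equivalence relation compatible with all the
fundamental operations. -/
def IsCongruence (L : Language) (B : Type*) [L.Structure B] (ρ : B → B → Prop) : Prop :=
  Equivalence ρ ∧
    ∀ {n : ℕ} (f : L.Functions n) (v w : Fin n → B),
      (∀ i, ρ (v i) (w i)) → ρ (Structure.funMap f v) (Structure.funMap f w)

/-- `PrinCg L B a b x y` says that `(x, y)` lies in the principal congruence
`Cg^B(a,b)` generated by the pair `(a,b)`. -/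
def PrinCg (L : Language) (B : Type*) [L.Structure B] (a b x y : B) : Prop :=
  ∀ ρ : B → B → Prop, IsCongruence L B ρ → ρ a b → ρ x y

/-- `B` satisfies every identity holding in `A`; by Birkhoff's theorem this says
exactly that `B` belongs to the variety generated by `A`. -/
def ModelsIdsOf (L : Language) (A : Type*) [L.Structure A] (B : Type*) [L.Structure B] : Prop :=
  ∀ t₁ t₂ : L.Term ℕ,
    (∀ v : ℕ → A, t₁.realize v = t₂.realize v) →
    ∀ v : ℕ → B, t₁.realize v = t₂.realize v

/-- Membership in the variety `V(A'(T))` generated by `A'(T)`. -/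
def InVariety (T : TM) (B : Type*) [(Sig T).Structure B] : Prop :=
  ModelsIdsOf (Sig T) (El T) B

/-- The variety `V(A'(T))` as a class of algebras. -/
def VClass (T : TM) : ∀ (B : Type) [inst : (Sig T).Structure B], Prop :=
  fun B inst => @InVariety T B inst

/-- `φ(w,x,y,z)` is a congruence formula for the class `C`: in every member of `C`
it implies `(w,x) ∈ Cg(y,z)`. -/
def IsCongruenceFormula (L : Language) (C : ∀ (B : Type) [inst : L.Structure B], Prop)
    (φ : L.Formula (Fin 4)) : Prop :=
  ∀ (B : Type) [L.Structure B], C B → ∀ w x y z : B,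
    φ.Realize ![w, x, y, z] → PrinCg L B y z w x

/-- The class `C` has definable principal subcongruences: there are congruence
formulas `Γ` and `ψ` such that any pair `a ≠ b` admits a subpair `c ≠ d` of
`Cg(a,b)` (witnessed by `Γ`) whose principal congruence is defined by `ψ`. -/
def HasDPSC (L : Language) (C : ∀ (B : Type) [inst : L.Structure B], Prop) : Prop :=
  ∃ Γ ψ : L.Formula (Fin 4),
    IsCongruenceFormula L C Γ ∧ IsCongruenceFormula L C ψ ∧
      ∀ (B : Type) [L.Structure B], C B → ∀ a b : B, a ≠ b →
        ∃ c d : B, c ≠ d ∧ Γ.Realize ![c, d, a, b] ∧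
          ∀ x y : B, PrinCg L B c d x y ↔ ψ.Realize ![x, y, c, d]

/-- The variety `V(A'(T))` is axiomatized by a finite set of identities
(which hold in `A'(T)`). -/
def FinitelyBased (T : TM) : Prop :=
  ∃ E : List ((Sig T).Term ℕ × (Sig T).Term ℕ),
    (∀ e ∈ E, ∀ v : ℕ → El T, e.1.realize v = e.2.realize v) ∧
    ∀ (B : Type) [(Sig T).Structure B],
      (InVariety T B ↔ ∀ e ∈ E, ∀ v : ℕ → B, e.1.realize v = e.2.realize v)

/-- An algebra is subdirectly irreducible iff some pair `a ≠ b` (generating the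
monolith) belongs to every nontrivial congruence. -/
def IsSI (L : Language) (B : Type*) [L.Structure B] : Prop :=
  ∃ a b : B, a ≠ b ∧ ∀ c d : B, c ≠ d → PrinCg L B c d a b

/-- An algebra is finitely subdirectly irreducible iff any two nontrivial principal
congruences have nontrivial intersection. -/
def IsFSI (L : Language) (B : Type*) [L.Structure B] : Prop :=
  ∀ a b c d : B, a ≠ b → c ≠ d →
    ∃ x y : B, x ≠ y ∧ PrinCg L B a b x y ∧ PrinCg L B c d x y

/-- The residual bound of `V(A'(T))` is finite (`κ(A'(T)) < ω`): there is a finite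
bound strictly larger than the cardinality of every subdirectly irreducible member. -/
def ResBoundFinite (T : TM) : Prop :=
  ∃ N : ℕ, ∀ (B : Type) [(Sig T).Structure B],
    InVariety T B → IsSI (Sig T) B → Finite B ∧ Nat.card B < N

/-- Membership in `HS(A'(T))`: homomorphic images of subalgebras of `A'(T)`. -/
def InHS (T : TM) (B : Type*) [(Sig T).Structure B] : Prop :=
  ∃ (S : (Sig T).Substructure (El T)) (f : S →[Sig T] B), Function.Surjective f

/-- The constant `0` of an algebra in the signature of `A'(T)`. -/
def zeroB (T : TM) (B : Type*) [(Sig T).Structure B] : B :=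
  Structure.funMap (fn0 T) (fun i : Fin 0 => i.elim0)

/-- The meet operation of an algebra in the signature of `A'(T)`. -/
def meetB (T : TM) {B : Type*} [(Sig T).Structure B] (x y : B) : B :=
  Structure.funMap (fn2 T Ops2.meet) ![x, y]

/-- The multiplication of an algebra in the signature of `A'(T)`. -/
def mulB (T : TM) {B : Type*} [(Sig T).Structure B] (x y : B) : B :=
  Structure.funMap (fn2 T Ops2.mul) ![x, y]

/-- The operation `I` of an algebra in the signature of `A'(T)`. -/
def IB (T : TM) {B : Type*} [(Sig T).Structure B] (x : B) : B :=
  Structure.funMap (fn1 T Ops1.I) ![x]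

/-- The operation `J` of an algebra in the signature of `A'(T)`. -/
def JB (T : TM) {B : Type*} [(Sig T).Structure B] (x y z : B) : B :=
  Structure.funMap (fn3 T Ops3.J) ![x, y, z]

/-- The operation `J'` of an algebra in the signature of `A'(T)`. -/
def J'B (T : TM) {B : Type*} [(Sig T).Structure B] (x y z : B) : B :=
  Structure.funMap (fn3 T Ops3.J') ![x, y, z]

/-- The operation `K` of an algebra in the signature of `A'(T)`. -/
def KB (T : TM) {B : Type*} [(Sig T).Structure B] (x y z : B) : B :=
  Structure.funMap (fn3 T Ops3.K) ![x, y, z]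

/-- The operation `S₂` of an algebra in the signature of `A'(T)`. -/
def S2B (T : TM) {B : Type*} [(Sig T).Structure B] (u v x y z : B) : B :=
  Structure.funMap (fn5 T Ops5.S2) ![u, v, x, y, z]

/-- The term `e₂(m,n,x) = S₂(m,n,x,x,x)`. -/
def e2B (T : TM) {B : Type*} [(Sig T).Structure B] (m n x : B) : B :=
  S2B T m n x x x

/-- The semilattice order of an algebra in the signature of `A'(T)`:
`x ≤ y` iff `x ∧ y = x`. -/
def leB (T : TM) {B : Type*} [(Sig T).Structure B] (x y : B) : Prop :=
  meetB T x y = x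

/-- Parameters `m̄ ∈ B² ∪ B` for one of the operations `S₀`, `S₁`, `S₂`. -/
inductive SIdx (B : Type*) : Type _
  | s0 (m : B)
  | s1 (m : B)
  | s2 (m n : B)

/-- Which of `S₀, S₁, S₂` a parameter tuple belongs to. -/
def SIdx.tag {B : Type*} : SIdx B → Fin 3
  | .s0 _ => 0
  | .s1 _ => 1
  | .s2 _ _ => 2

/-- `SApp T σ x y z` is `S_i(m̄, x, y, z)` where `σ` packages `i` and `m̄`. -/
def SApp (T : TM) {B : Type*} [(Sig T).Structure B] : SIdx B → B → B → B → B
  | .s0 m, x, y, z => Structure.funMap (fn4 T Ops4.S0) ![m, x, y, z]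
  | .s1 m, x, y, z => Structure.funMap (fn4 T Ops4.S1) ![m, x, y, z]
  | .s2 m n, x, y, z => S2B T m n x y z

/-- `eApp T σ x` is the term function `e_i(m̄, x) = S_i(m̄, x, x, x)`. -/
def eApp (T : TM) {B : Type*} [(Sig T).Structure B] (σ : SIdx B) (x : B) : B :=
  SApp T σ x x x

/-- `Range(S_j)`: the set of values of the operation `S_j` on `B`. -/
def SRange (T : TM) (B : Type*) [(Sig T).Structure B] (j : Fin 3) : Set B :=
  {w | ∃ (σ : SIdx B) (x y z : B), σ.tag = j ∧ SApp T σ x y z = w}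

/-- A unary polynomial of `B`: a term function in one variable with parameters
from `B`. -/
def IsPolynomial (T : TM) {B : Type*} [(Sig T).Structure B] (f : B → B) : Prop :=
  ∃ t : (Sig T).Term (B ⊕ Unit), ∀ x : B, f x = t.realize (Sum.elim id fun _ => x)

/-- A fundamental translation: a unary polynomial obtained from a fundamental
operation by fixing all arguments but one. -/
def IsFundTranslation (T : TM) {B : Type*} [(Sig T).Structure B] (g : B → B) : Prop :=
  ∃ (n : ℕ) (F : (Sig T).Functions n) (i : Fin n) (v : Fin n → B),
    g = fun x => Structure.funMap F (Function.update v i x)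

/-- A polynomial generated by fundamental translations: a composition of finitely
many fundamental translations. -/
inductive IsTransPoly (T : TM) {B : Type*} [(Sig T).Structure B] : (B → B) → Prop
  | id : IsTransPoly T id
  | comp {g f : B → B} : IsFundTranslation T g → IsTransPoly T f → IsTransPoly T (g ∘ f)

end McKenzie



namespace McKenzie

open Language

namespace El

variable {T : TM}

lemma bar_eq_some_symm {x y : El T} (h : bar y = some x) : bar x = some y := by
  cases y <;> simp [bar] at h <;> subst h <;> simp [bar]

lemma bar_ne_self (x : El T) : bar x ≠ some x := by
  cases x <;> simp [bar]

lemma bar_ne_zero (x : El T) : bar x ≠ some zero := by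
  cases x <;> simp [bar]

@[simp] lemma bar_zero : bar (zero : El T) = none := rfl

@[simp] lemma meet_self (x : El T) : meet x x = x := by simp [meet]

@[simp] lemma zero_meet (x : El T) : meet zero x = zero := by simp [meet]

@[simp] lemma meet_zero (x : El T) : meet x zero = zero := by
  simp +contextual [meet]

lemma meet_eq_zero_or (x y : El T) : meet x y = zero ∨ x = y := by
  unfold meet; split_ifs <;> simp_all

@[simp] lemma sCore_self (x : El T) : sCore x x x = x := by
  simp [sCore, fjoin]

@[simp] lemma mul_zero (x : El T) : mul x zero = zero := by cases x <;> rfl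

@[simp] lemma zero_mul (x : El T) : mul zero x = zero := rfl

@[simp] lemma mach_zero_left (ins : Instr T.states) (t : Bool) (y u : El T) :
    mach ins t zero y u = zero := by
  simp [mach, opL, opR]

@[simp] lemma mach_zero_mid (ins : Instr T.states) (t : Bool) (x u : El T) :
    mach ins t x zero u = zero := by
  cases x <;> simp [mach, opL, opR]

@[simp] lemma mach_zero_right (ins : Instr T.states) (t : Bool) (x y : El T) :
    mach ins t x y zero = zero := by
  cases x <;> cases y <;> simp [mach, opL, opR]

lemma opJ'_eq (p q z : El T) :
    (bar q = some p ∧ opJ' p q z = p) ∨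
      (opJ' p q z = z ∧ p = z ∧ q = z) ∨ opJ' p q z = zero := by
  unfold opJ' meet
  split_ifs <;> simp_all

/-- Decomposition of an element below `J'(a,b,z)` into its part on which `a = ∂b`
and its part below `z`. -/
lemma meet_opJ'_eq (u a b z : El T) :
    meet u (opJ' a b z) =
      opJ a (opJ' b a (meet b (meet (opJ' a b z) (meet u z))))
        (meet (opS2 a b u u u) (opJ' a b z)) := by
  have h1 := bar_ne_self a
  by_cases hb : bar b = some a
  · have h2 := bar_eq_some_symm hb
    have hab : a ≠ b := by rintro rfl; exact h1 hb
    have hba : b ≠ a := fun h => hab h.symm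
    simp only [opJ', opS2, sCore_self, hb, h2, hab, hba, if_true, if_false, opJ]
    grind [meet]
  · have h2 : bar a ≠ some b := fun h => hb (bar_eq_some_symm h)
    by_cases hab : a = b
    · subst hab
      have hz := bar_zero (T := T)
      simp only [opJ', opS2, opJ, hb, if_true, if_false]
      grind [meet]
    · have hba : b ≠ a := fun h => hab h.symm
      simp only [opJ', opS2, opJ, hb, h2, hab, hba, if_false, meet_zero]
      simp +contextual

lemma eq_opJ'_of_mem {X y : El T} (h : X = zero ∨ X = y ∨ bar y = some X) :
    X = opJ' X y y := by
  rcases h with rfl | rfl | h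
  · unfold opJ'
    have := bar_ne_zero y
    split_ifs <;> simp_all
  · simp [opJ']
  · have : X ≠ y := by rintro rfl; exact bar_ne_self _ h
    simp [opJ', this, h]

lemma opJ_mem (a y z : El T) :
    opJ a y z = zero ∨ opJ a y z = y ∨ bar y = some (opJ a y z) := by
  grind [opJ, meet]

lemma opJ'_mem (a y z : El T) :
    opJ' a y z = zero ∨ opJ' a y z = y ∨ bar y = some (opJ' a y z) := by
  grind [opJ', meet]

lemma opK_mem_left (x y z : El T) :
    opK x y z = zero ∨ opK x y z = x ∨ bar x = some (opK x y z) := by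
  have h := @bar_eq_some_symm T
  grind [opK, meet]

lemma opK_mem_mid (x y z : El T) :
    opK x y z = zero ∨ opK x y z = y ∨ bar y = some (opK x y z) := by
  have h := @bar_eq_some_symm T
  grind [opK, meet]

lemma opK_eq_opJ' (a b z : El T) : opK a b z = opJ' (opK a b z) (opK b a z) z := by
  have h := @bar_eq_some_symm T
  have h' := @bar_ne_self T
  grind (splits := 20) [opK, opJ', meet]

lemma opT_mem_left (w x y z : El T) :
    opT w x y z = zero ∨ opT w x y z = mul w x ∨ bar (mul w x) = some (opT w x y z) := by
  by_cases h : mul w x = mul y z ∧ ¬ (w = y ∧ x = z) ∧ mul w x ≠ zero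
  · unfold opT
    rw [if_pos h.1, if_neg h.2.1, if_pos h.2.2]
    cases bar (mul w x) <;> simp
  · grind [opT]

lemma opT_mem_right (w x y z : El T) :
    opT w x y z = zero ∨ opT w x y z = mul y z ∨ bar (mul y z) = some (opT w x y z) := by
  by_cases h : mul w x = mul y z
  · rw [← h]; exact opT_mem_left w x y z
  · simp [opT, h]

/-- A map which preserves `0`, is injective away from its zeros, and commutes with `∂`,
commutes with `J'`. -/
lemma map_opJ' {φ : El T → El T} (h0 : φ zero = zero)
    (hinj : ∀ x y, φ x = φ y → φ x ≠ zero → x = y)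
    (hbar : ∀ x y, bar y = some x → (φ x = zero ∧ φ y = zero) ∨ bar (φ y) = some (φ x))
    (hbar' : ∀ x y, bar (φ y) = some (φ x) → bar y = some x) (a b z : El T) :
    φ (opJ' a b z) = opJ' (φ a) (φ b) (φ z) := by
  by_cases hab : a = b
  · subst hab
    by_cases haz : a = z
    · subst haz; simp [opJ']
    · have : φ a = φ z → φ a = zero := fun h => by
        by_contra h'; exact haz (hinj _ _ h h')
      simp only [opJ', meet, haz, if_true, if_false, h0]
      split_ifs with h
      · exact (this h).symm
      · rfl
  · by_cases hb : bar b = some a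
    · simp only [opJ', hab, hb, if_true, if_false]
      rcases hbar _ _ hb with ⟨h1, h2⟩ | h
      · simp [h1, h2]
      · have : φ a ≠ φ b := fun h' => bar_ne_self (φ b) (by rw [h, h'])
        simp [h, this]
    · have h1 : ¬ bar (φ b) = some (φ a) := fun h => hb (hbar' _ _ h)
      simp only [opJ', hab, hb, h1, if_false, h0]
      split_ifs with h
      · by_cases h2 : φ a = zero
        · simp [h2]
        · exact absurd (hinj _ _ h h2) hab
      · rfl

lemma mul_opJ' (m a b z : El T) :
    mul m (opJ' a b z) = opJ' (mul m a) (mul m b) (mul m z) := by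
  apply map_opJ' (φ := mul m)
  · simp
  · intro x y h h'
    cases m <;> cases x <;> simp [mul] at h h' <;> cases y <;> simp_all
  · intro x y h
    cases m <;> cases y <;> simp [bar] at h <;> subst h <;> simp [mul, bar]
  · intro x y h
    cases m <;> cases y <;> simp [bar, mul] at h <;> cases x <;> simp_all [bar]

lemma opL_opJ' (ins : Instr T.states) (t : Bool) (x y a b z : El T) :
    opL ins t x y (opJ' a b z) =
      opJ' (opL ins t x y a) (opL ins t x y b) (opL ins t x y z) := by
  apply map_opJ' (φ := opL ins t x y)
  · cases x <;> cases y <;> rfl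
  · intro p q h h'
    cases x <;> (try exact absurd rfl h') <;> cases y <;> (try exact absurd rfl h') <;>
      cases p <;> (try exact absurd rfl h') <;> cases q <;> simp only [opL] at h h' ⊢ <;> grind
  · intro p q h
    cases x <;> (try exact Or.inl ⟨rfl, rfl⟩) <;> cases y <;> (try exact Or.inl ⟨rfl, rfl⟩) <;>
      cases q <;> simp only [bar, reduceCtorEq, Option.some.injEq] at h <;> subst h <;>
      simp only [opL] <;> grind [bar]
  · intro p q h
    have hb := @bar_zero T
    have hb' := @bar_ne_zero T
    cases x <;> (try exact absurd h (hb' _)) <;> cases y <;> (try exact absurd h (hb' _)) <;>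
      cases p <;> (try exact absurd h (hb' _)) <;> cases q <;> simp only [opL] at h ⊢ <;>
      grind [bar]

lemma opR_opJ' (ins : Instr T.states) (t : Bool) (x y a b z : El T) :
    opR ins t x y (opJ' a b z) =
      opJ' (opR ins t x y a) (opR ins t x y b) (opR ins t x y z) := by
  apply map_opJ' (φ := opR ins t x y)
  · cases x <;> cases y <;> rfl
  · intro p q h h'
    cases x <;> (try exact absurd rfl h') <;> cases y <;> (try exact absurd rfl h') <;>
      cases p <;> (try exact absurd rfl h') <;> cases q <;> simp only [opR] at h h' ⊢ <;> grind
  · intro p q h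
    cases x <;> (try exact Or.inl ⟨rfl, rfl⟩) <;> cases y <;> (try exact Or.inl ⟨rfl, rfl⟩) <;>
      cases q <;> simp only [bar, reduceCtorEq, Option.some.injEq] at h <;> subst h <;>
      simp only [opR] <;> grind [bar]
  · intro p q h
    have hb := @bar_zero T
    have hb' := @bar_ne_zero T
    cases x <;> (try exact absurd h (hb' _)) <;> cases y <;> (try exact absurd h (hb' _)) <;>
      cases p <;> (try exact absurd h (hb' _)) <;> cases q <;> simp only [opR] at h ⊢ <;>
      grind [bar]

lemma mach_opJ' (ins : Instr T.states) (t : Bool) (x y a b z : El T) :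
    mach ins t x y (opJ' a b z) =
      opJ' (mach ins t x y a) (mach ins t x y b) (mach ins t x y z) := by
  unfold mach
  split_ifs
  exacts [opR_opJ' ins t x y a b z, opL_opJ' ins t x y a b z]

/-- A map preserving `0` and vanishing on the domain of `∂` is strict in the last
argument of `J'`. -/
lemma map_opJ'_of_zero {φ : El T → El T} (h0 : φ zero = zero)
    (hφ : ∀ x y, bar y = some x → φ x = zero) (a b z : El T) :
    φ (opJ' a b z) = opJ' (φ (opJ' a b z)) (φ (opJ' a b z)) (φ z) := by
  rcases opJ'_eq a b z with ⟨h, h'⟩ | ⟨h, -, -⟩ | h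
  · rw [h', hφ _ _ h]; simp [opJ']
  · rw [h]; simp [opJ']
  · rw [h, h0]; simp [opJ']

lemma mul_eq_zero_of_bar {x y : El T} (h : bar y = some x) (m : El T) : mul x m = zero := by
  cases y <;> simp [bar] at h <;> subst h <;> simp [mul]

lemma opI_eq_zero_of_bar {x y : El T} (h : bar y = some x) : opI x = zero := by
  cases y <;> simp [bar] at h <;> subst h <;> simp [opI]

lemma mach_left_eq_zero_of_bar {x y : El T} (h : bar y = some x) (ins : Instr T.states)
    (t : Bool) (p q : El T) : mach ins t x p q = zero := by
  cases y <;> simp [bar] at h <;> subst h <;> simp [mach, opL, opR]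

lemma mach_mid_eq_zero_of_bar {x y : El T} (h : bar y = some x) (ins : Instr T.states)
    (t : Bool) (p q : El T) : mach ins t p x q = zero := by
  cases y <;> simp [bar] at h <;> subst h <;> cases p <;> simp [mach, opL, opR]

/-- The flat order. -/
def le (x y : El T) : Prop := x = zero ∨ x = y

lemma le_refl (x : El T) : le x x := Or.inr rfl

lemma opJ_mono {x x' y y' z z' : El T} (hx : le x x') (hy : le y y') (hz : le z z') :
    le (opJ x y z) (opJ x' y' z') := by
  have h := @bar_ne_zero T
  rcases hx with rfl | rfl <;> rcases hy with rfl | rfl <;> rcases hz with rfl | rfl <;>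
    grind (splits := 20) [opJ, le, meet, bar_zero]

lemma opJ'_mono {x x' y y' z z' : El T} (hx : le x x') (hy : le y y') (hz : le z z') :
    le (opJ' x y z) (opJ' x' y' z') := by
  have h := @bar_ne_zero T
  rcases hx with rfl | rfl <;> rcases hy with rfl | rfl <;> rcases hz with rfl | rfl <;>
    grind (splits := 20) [opJ', le, meet, bar_zero]

lemma opK_mono {x x' y y' z z' : El T} (hx : le x x') (hy : le y y') (hz : le z z') :
    le (opK x y z) (opK x' y' z') := by
  have h := @bar_ne_zero T
  rcases hx with rfl | rfl <;> rcases hy with rfl | rfl <;> rcases hz with rfl | rfl <;>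
    grind (splits := 20) [opK, le, meet, bar_zero]

lemma sCore_mono {x x' y y' z z' : El T} (hx : le x x') (hy : le y y') (hz : le z z') :
    le (sCore x y z) (sCore x' y' z') := by
  rcases hx with rfl | rfl <;> rcases hy with rfl | rfl <;> rcases hz with rfl | rfl <;>
    simp only [sCore, le, meet, fjoin] <;> split_ifs <;> simp_all

lemma opT_mono {w w' x x' y y' z z' : El T} (hw : le w w') (hx : le x x') (hy : le y y')
    (hz : le z z') : le (opT w x y z) (opT w' x' y' z') := by
  rcases hw with rfl | rfl
  · left; simp [opT]
  rcases hx with rfl | rfl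
  · left; simp [opT]
  rcases hy with rfl | rfl
  · left; simp +contextual [opT]
  rcases hz with rfl | rfl
  · left; simp +contextual [opT]
  exact le_refl _

lemma mach_mono (ins : Instr T.states) (t : Bool) {x x' y y' z z' : El T}
    (hx : le x x') (hy : le y y') (hz : le z z') :
    le (mach ins t x y z) (mach ins t x' y' z') := by
  rcases hx with rfl | rfl
  · left; simp
  rcases hy with rfl | rfl
  · left; simp
  rcases hz with rfl | rfl
  · left; simp
  exact le_refl _

lemma prec_left {x z : El T} (h : prec x z = true) : x = one ∨ x = two := by
  cases x <;> simp_all [prec]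

lemma prec_zero (x : El T) : prec x zero = false := by
  cases x <;> simp [prec]

lemma zero_prec (x : El T) : prec zero x = false := by
  cases x <;> simp [prec]

lemma opU1_mono (ins : Instr T.states) (t : Bool) {w w' x x' y y' z z' : El T}
    (hw : le w w') (hx : le x x') (hy : le y y') (hz : le z z') :
    le (opU1 (mach ins t) w x y z) (opU1 (mach ins t) w' x' y' z') := by
  rcases hw with rfl | rfl
  · left; simp [opU1, zero_prec]
  rcases hx with rfl | rfl
  · left; simp [opU1]
  rcases hy with rfl | rfl
  · left; simp [opU1, prec_zero]
  rcases hz with rfl | rfl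
  · left; simp [opU1]
  exact le_refl _

lemma opU0_mono (ins : Instr T.states) (t : Bool) {w w' x x' y y' z z' : El T}
    (hw : le w w') (hx : le x x') (hy : le y y') (hz : le z z') :
    le (opU0 (mach ins t) w x y z) (opU0 (mach ins t) w' x' y' z') := by
  rcases hw with rfl | rfl
  · left; simp [opU0, zero_prec]
  rcases hx with rfl | rfl
  · left; simp [opU0]
  rcases hy with rfl | rfl
  · left; simp [opU0, prec_zero]
  rcases hz with rfl | rfl
  · left; simp [opU0]
  exact le_refl _

lemma meet_mono {x x' y y' : El T} (hx : le x x') (hy : le y y') :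
    le (meet x y) (meet x' y') := by
  rcases hx with rfl | rfl
  · left; simp
  rcases hy with rfl | rfl
  · left; simp
  exact le_refl _

lemma mul_mono {x x' y y' : El T} (hx : le x x') (hy : le y y') :
    le (mul x y) (mul x' y') := by
  rcases hx with rfl | rfl
  · left; simp
  rcases hy with rfl | rfl
  · left; simp
  exact le_refl _

lemma opI_mono {x x' : El T} (hx : le x x') : le (opI x) (opI x') := by
  rcases hx with rfl | rfl
  · left; simp [opI]
  exact le_refl _

lemma opS0_mono {u u' x x' y y' z z' : El T} (hu : le u u') (hx : le x x') (hy : le y y')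
    (hz : le z z') : le (opS0 u x y z) (opS0 u' x' y' z') := by
  rcases hu with rfl | rfl
  · left; simp [opS0, isV0]
  unfold opS0
  split_ifs
  exacts [sCore_mono hx hy hz, le_refl _]

lemma opS1_mono {u u' x x' y y' z z' : El T} (hu : le u u') (hx : le x x') (hy : le y y')
    (hz : le z z') : le (opS1 u x y z) (opS1 u' x' y' z') := by
  rcases hu with rfl | rfl
  · left; simp [opS1]
  unfold opS1
  split_ifs
  exacts [sCore_mono hx hy hz, le_refl _]

lemma opS2_mono {u u' v v' x x' y y' z z' : El T} (hu : le u u') (hv : le v v')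
    (hx : le x x') (hy : le y y') (hz : le z z') :
    le (opS2 u v x y z) (opS2 u' v' x' y' z') := by
  rcases hu with rfl | rfl
  · left; simp [opS2, bar_ne_zero]
  rcases hv with rfl | rfl
  · left; simp [opS2]
  unfold opS2
  split_ifs
  exacts [sCore_mono hx hy hz, le_refl _]

lemma funMap_mono {n : ℕ} (f : (Sig T).Functions n) {v w : Fin n → El T}
    (h : ∀ i, le (v i) (w i)) : le (Structure.funMap f v) (Structure.funMap f w) := by
  match n, f with
  | 0, _ => exact le_refl _
  | 1, Ops1.I => exact opI_mono (h 0)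
  | 2, Ops2.meet => exact meet_mono (h 0) (h 1)
  | 2, Ops2.mul => exact mul_mono (h 0) (h 1)
  | 3, Ops3.J => exact opJ_mono (h 0) (h 1) (h 2)
  | 3, Ops3.J' => exact opJ'_mono (h 0) (h 1) (h 2)
  | 3, Ops3.K => exact opK_mono (h 0) (h 1) (h 2)
  | 3, Ops3.mach k t => exact mach_mono _ t (h 0) (h 1) (h 2)
  | 4, Ops4.S0 => exact opS0_mono (h 0) (h 1) (h 2) (h 3)
  | 4, Ops4.S1 => exact opS1_mono (h 0) (h 1) (h 2) (h 3)
  | 4, Ops4.T => exact opT_mono (h 0) (h 1) (h 2) (h 3)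
  | 4, Ops4.u1 k t => exact opU1_mono _ t (h 0) (h 1) (h 2) (h 3)
  | 4, Ops4.u0 k t => exact opU0_mono _ t (h 0) (h 1) (h 2) (h 3)
  | 5, Ops5.S2 => exact opS2_mono (h 0) (h 1) (h 2) (h 3) (h 4)
  | _ + 6, f => exact f.elim

lemma realize_mono {α : Type*} (τ : (Sig T).Term α) {v w : α → El T}
    (h : ∀ i, le (v i) (w i)) : le (τ.realize v) (τ.realize w) := by
  induction τ with
  | var i => exact h i
  | func f ts ih => exact funMap_mono f ih

lemma meet_eq_left {x y : El T} (h : le x y) : meet x y = x := by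
  rcases h with rfl | rfl <;> simp

lemma meet_le_right (x y : El T) : le (meet x y) y := by
  rcases meet_eq_zero_or x y with h | rfl
  · exact Or.inl h
  · simp [le_refl]

lemma opS0_opS0 (u x y z : El T) :
    opS0 u (opS0 u x y z) (opS0 u x y z) (opS0 u x y z) = opS0 u x y z := by
  simp only [opS0, sCore_self]
  split_ifs <;> rfl

lemma opS1_opS1 (u x y z : El T) :
    opS1 u (opS1 u x y z) (opS1 u x y z) (opS1 u x y z) = opS1 u x y z := by
  simp only [opS1, sCore_self]
  split_ifs <;> rfl

lemma opS2_opS2 (p q x y z : El T) :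
    opS2 p q (opS2 p q x y z) (opS2 p q x y z) (opS2 p q x y z) = opS2 p q x y z := by
  simp only [opS2, sCore_self]
  split_ifs <;> rfl

lemma opS1_opU1 (F : El T → El T → El T → El T) (x y z u : El T) :
    opS1 x (opU1 F x y z u) (opU1 F x y z u) (opU1 F x y z u) = opU1 F x y z u := by
  rw [opS1, sCore_self, ite_eq_left_iff]
  intro h
  rw [opU1, if_neg (mt prec_left h)]

lemma opS1_opU0 (F : El T → El T → El T → El T) (x y z u : El T) :
    opS1 x (opU0 F x y z u) (opU0 F x y z u) (opU0 F x y z u) = opU0 F x y z u := by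
  rw [opS1, sCore_self, ite_eq_left_iff]
  intro h
  rw [opU0, if_neg (mt prec_left h)]

/-- `z` enters `J(x,y,z)` only where `x = ∂y`. -/
lemma opJ_opS2 (x y z : El T) : opJ x y (opS2 x y z z z) = opJ x y z := by
  simp only [opJ, opS2, sCore_self]
  split_ifs <;> rfl

end El

section Representation

variable {T : TM} {B : Type*} [(Sig T).Structure B]

/-- The identities of `A'(T)` hold in every algebra of the variety, for arbitrary sets of
variables. -/
lemma InVariety.realize_eq (hB : InVariety T B) {α : Type*} {τ₁ τ₂ : (Sig T).Term α}
    (h : ∀ v : α → El T, τ₁.realize v = τ₂.realize v) (w : α → B) :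
    τ₁.realize w = τ₂.realize w := by
  classical
  rcases isEmpty_or_nonempty α with hα | hα
  · have := hB (τ₁.relabel hα.elim) (τ₂.relabel hα.elim)
      (fun v => by simpa only [Term.realize_relabel] using h _)
      (fun _ => τ₁.realize w)
    simp only [Term.realize_relabel] at this
    convert this using 2
  · set s : Set α := ↑(τ₁.varFinset ∪ τ₂.varFinset) with hs
    have hcount : s.Countable := Finset.countable_toSet _
    obtain ⟨e, he⟩ := Set.countable_iff_exists_injOn.1 hcount
    have hinv := he.leftInvOn_invFunOn
    have key := hB (τ₁.relabel e) (τ₂.relabel e)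
      (fun v => by simpa only [Term.realize_relabel] using h _)
      (w ∘ Function.invFunOn e s)
    simp only [Term.realize_relabel] at key
    have h₁ : (τ₁.varFinset : Set α) ⊆ s := by simp [hs]
    have h₂ : (τ₂.varFinset : Set α) ⊆ s := by simp [hs]
    rw [← Term.realize_restrictVar' h₁, ← Term.realize_restrictVar' h₂] at key ⊢
    have hw : ((w ∘ Function.invFunOn e s) ∘ e) ∘ ((↑) : s → α) = w ∘ ((↑) : s → α) := by
      funext x
      exact congrArg w (hinv x.2)
    rwa [hw] at key

/-- `Rep b φ`: some term over `B` has value `b` in `B` and induces `φ` on `A'(T)`. -/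
def Rep (b : B) (φ : (B → El T) → El T) : Prop :=
  ∃ τ : (Sig T).Term B, τ.realize id = b ∧ ∀ v, τ.realize v = φ v

lemma Rep.eq (hB : InVariety T B) {a b : B} {φ ψ : (B → El T) → El T} (ha : Rep a φ)
    (hb : Rep b ψ) (h : ∀ v, φ v = ψ v) : a = b := by
  obtain ⟨τ, rfl, hτ⟩ := ha
  obtain ⟨σ, rfl, hσ⟩ := hb
  exact hB.realize_eq (fun v => by rw [hτ, hσ, h]) id

lemma Rep.var (b : B) : Rep b (fun v : B → El T => v b) :=
  ⟨Term.var b, rfl, fun _ => rfl⟩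

lemma Rep.func {n : ℕ} (f : (Sig T).Functions n) {w : Fin n → B}
    {φ : Fin n → (B → El T) → El T} (h : ∀ i, Rep (w i) (φ i)) :
    Rep (Structure.funMap f w) (fun v => Structure.funMap f fun i => φ i v) := by
  choose τ hτ hτ' using h
  refine ⟨Term.func f τ, ?_, fun v => ?_⟩
  · simp [Term.realize_func, hτ]
  · simp [Term.realize_func, hτ']

variable {a b c d e : B} {φ₁ φ₂ φ₃ φ₄ φ₅ : (B → El T) → El T}

lemma Rep.I (h₁ : Rep a φ₁) : Rep (IB T a) (fun v => El.opI (φ₁ v)) :=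
  Rep.func (fn1 T Ops1.I) (w := ![a]) (φ := ![φ₁]) (by simp [*])

lemma Rep.meet (h₁ : Rep a φ₁) (h₂ : Rep b φ₂) :
    Rep (meetB T a b) (fun v => El.meet (φ₁ v) (φ₂ v)) :=
  Rep.func (fn2 T Ops2.meet) (w := ![a, b]) (φ := ![φ₁, φ₂]) (by simp [Fin.forall_fin_succ, *])

lemma Rep.mul (h₁ : Rep a φ₁) (h₂ : Rep b φ₂) :
    Rep (mulB T a b) (fun v => El.mul (φ₁ v) (φ₂ v)) :=
  Rep.func (fn2 T Ops2.mul) (w := ![a, b]) (φ := ![φ₁, φ₂]) (by simp [Fin.forall_fin_succ, *])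

lemma Rep.J (h₁ : Rep a φ₁) (h₂ : Rep b φ₂) (h₃ : Rep c φ₃) :
    Rep (JB T a b c) (fun v => El.opJ (φ₁ v) (φ₂ v) (φ₃ v)) :=
  Rep.func (fn3 T Ops3.J) (w := ![a, b, c]) (φ := ![φ₁, φ₂, φ₃])
    (by simp [Fin.forall_fin_succ, *])

lemma Rep.J' (h₁ : Rep a φ₁) (h₂ : Rep b φ₂) (h₃ : Rep c φ₃) :
    Rep (J'B T a b c) (fun v => El.opJ' (φ₁ v) (φ₂ v) (φ₃ v)) :=
  Rep.func (fn3 T Ops3.J') (w := ![a, b, c]) (φ := ![φ₁, φ₂, φ₃])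
    (by simp [Fin.forall_fin_succ, *])

lemma Rep.K (h₁ : Rep a φ₁) (h₂ : Rep b φ₂) (h₃ : Rep c φ₃) :
    Rep (KB T a b c) (fun v => El.opK (φ₁ v) (φ₂ v) (φ₃ v)) :=
  Rep.func (fn3 T Ops3.K) (w := ![a, b, c]) (φ := ![φ₁, φ₂, φ₃])
    (by simp [Fin.forall_fin_succ, *])

/-- The machine operations of an algebra in the signature of `A'(T)`. -/
def machB (k : Fin T.instr.length) (t : Bool) (x y z : B) : B :=
  Structure.funMap (fn3 T (Ops3.mach k t)) ![x, y, z]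

lemma Rep.mach (k : Fin T.instr.length) (t : Bool) (h₁ : Rep a φ₁) (h₂ : Rep b φ₂)
    (h₃ : Rep c φ₃) :
    Rep (machB k t a b c) (fun v => El.mach (T.instr.get k) t (φ₁ v) (φ₂ v) (φ₃ v)) :=
  Rep.func (fn3 T (Ops3.mach k t)) (w := ![a, b, c]) (φ := ![φ₁, φ₂, φ₃])
    (by simp [Fin.forall_fin_succ, *])

/-- The 4-ary operations of an algebra in the signature of `A'(T)`. -/
def op4B (o : Ops4 T) (x y z u : B) : B := Structure.funMap (fn4 T o) ![x, y, z, u]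

lemma Rep.op4 (o : Ops4 T) (h₁ : Rep a φ₁) (h₂ : Rep b φ₂) (h₃ : Rep c φ₃)
    (h₄ : Rep d φ₄) :
    Rep (op4B o a b c d) (fun v => op4B o (φ₁ v) (φ₂ v) (φ₃ v) (φ₄ v)) := by
  unfold op4B
  have h := Rep.func (fn4 T o) (w := ![a, b, c, d]) (φ := ![φ₁, φ₂, φ₃, φ₄])
    (by simp [Fin.forall_fin_succ, *])
  have hv : ∀ v, (fun i => ![φ₁, φ₂, φ₃, φ₄] i v) = ![φ₁ v, φ₂ v, φ₃ v, φ₄ v] := fun v => by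
    funext i
    fin_cases i <;> rfl
  simpa only [hv] using h

lemma Rep.S2 (h₁ : Rep a φ₁) (h₂ : Rep b φ₂) (h₃ : Rep c φ₃) (h₄ : Rep d φ₄)
    (h₅ : Rep e φ₅) :
    Rep (S2B T a b c d e) (fun v => El.opS2 (φ₁ v) (φ₂ v) (φ₃ v) (φ₄ v) (φ₅ v)) :=
  Rep.func (fn5 T Ops5.S2) (w := ![a, b, c, d, e]) (φ := ![φ₁, φ₂, φ₃, φ₄, φ₅])
    (by simp [Fin.forall_fin_succ, *])

/-- `κ` describes on `A'(T)` the action of the unary map `k` of `B`. -/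
def PolyRep (k : B → B) (κ : (B → El T) → El T → El T) : Prop :=
  ∀ x φ, Rep x φ → Rep (k x) (fun v => κ v (φ v))

lemma PolyRep.of_term (τ : (Sig T).Term (B ⊕ Unit)) :
    PolyRep (fun x : B => τ.realize (Sum.elim id fun _ => x))
      (fun (v : B → El T) y => τ.realize (Sum.elim v fun _ => y)) := by
  rintro x φ ⟨σ, rfl, hσ⟩
  refine ⟨τ.subst (Sum.elim Term.var fun _ => σ), ?_, fun v => ?_⟩ <;>
  · rw [Term.realize_subst]
    congr 1
    funext i
    cases i <;> simp [hσ]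

lemma exists_polyRep_eApp (σ : SIdx B) :
    ∃ ε : (B → El T) → El T → El T, PolyRep (eApp T σ) ε ∧
      ∀ v, (∀ y, ε v y = y) ∨ ∀ y, ε v y = El.zero := by
  rcases σ with m | m | ⟨m, n⟩
  · refine ⟨fun v y => El.opS0 (v m) y y y,
      fun x φ h => Rep.op4 Ops4.S0 (Rep.var m) h h h, fun v => ?_⟩
    by_cases hm : El.isV0 (v m) <;> simp [El.opS0, hm]
  · refine ⟨fun v y => El.opS1 (v m) y y y,
      fun x φ h => Rep.op4 Ops4.S1 (Rep.var m) h h h, fun v => ?_⟩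
    by_cases hm : v m = El.one ∨ v m = El.two <;> simp [El.opS1, hm]
  · refine ⟨fun v y => El.opS2 (v m) (v n) y y y,
      fun x φ h => Rep.S2 (Rep.var m) (Rep.var n) h h h, fun v => ?_⟩
    by_cases hm : El.bar (v n) = some (v m) <;> simp [El.opS2, hm]

lemma eApp_polynomial_eq (hB : InVariety T B) (σ : SIdx B) (he : eApp T σ c = eApp T σ d)
    {g : B → B} {κ : (B → El T) → El T → El T} (hg : PolyRep g κ) :
    eApp T σ (g c) = eApp T σ (g d) := by
  obtain ⟨ε, hε, hε'⟩ := exists_polyRep_eApp (T := T) σ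
  have key : ∀ x, eApp T σ (g x) = eApp T σ (g (eApp T σ x)) := fun x =>
    Rep.eq hB (hε _ _ (hg _ _ (Rep.var x))) (hε _ _ (hg _ _ (hε _ _ (Rep.var x))))
      fun v => by rcases hε' v with h | h <;> simp [h]
  rw [key c, he, ← key d]

/-- Polynomial maps preserving `0` which turn values of `J'` into values of `J'`,
acting on the last argument. -/
structure IsTransfer (T : TM) {B : Type*} [(Sig T).Structure B] (k : B → B) : Prop where
  exists_polyRep : ∃ κ : (B → El T) → El T → El T, PolyRep k κ ∧ ∀ v, κ v El.zero = El.zero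
  exists_J' : ∀ a b z, ∃ a' b', k (J'B T a b z) = J'B T a' b' (k z)

lemma IsTransfer.id : IsTransfer T (id : B → B) :=
  ⟨⟨fun _ y => y, fun _ _ h => h, fun _ => rfl⟩, fun a b _ => ⟨a, b, rfl⟩⟩

lemma IsTransfer.comp {k l : B → B} (hk : IsTransfer T k) (hl : IsTransfer T l) :
    IsTransfer T (fun x => k (l x)) := by
  obtain ⟨⟨κ, h₁, h₂⟩, h₃⟩ := hk
  obtain ⟨⟨lam, h₁', h₂'⟩, h₃'⟩ := hl
  refine ⟨⟨fun v y => κ v (lam v y), fun x φ h => h₁ _ _ (h₁' _ _ h), by simp [h₂, h₂']⟩,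
    fun a b z => ?_⟩
  obtain ⟨p, q, hl⟩ := h₃' a b z
  obtain ⟨p', q', hk⟩ := h₃ p q (l z)
  exact ⟨p', q', by rw [hl, hk]⟩

/-- A map that commutes with `J'` up to changing its first two arguments. -/
lemma IsTransfer.of_opJ' (hB : InVariety T B) {k : B → B} {κ : (B → El T) → El T → El T}
    (hk : PolyRep k κ) (h0 : ∀ v, κ v El.zero = El.zero)
    (hJ : ∀ v a b z, κ v (El.opJ' a b z) = El.opJ' (κ v a) (κ v b) (κ v z)) :
    IsTransfer T k :=
  ⟨⟨κ, hk, h0⟩, fun a b z => ⟨k a, k b,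
    Rep.eq hB (hk _ _ ((Rep.var a).J' (Rep.var b) (Rep.var z)))
      ((hk _ _ (Rep.var a)).J' (hk _ _ (Rep.var b)) (hk _ _ (Rep.var z)))
      fun _ => hJ _ _ _ _⟩⟩

lemma IsTransfer.of_bar (hB : InVariety T B) {k : B → B} {κ : (B → El T) → El T → El T}
    (hk : PolyRep k κ) (h0 : ∀ v, κ v El.zero = El.zero)
    (hbar : ∀ v x y, El.bar y = some x → κ v x = El.zero) : IsTransfer T k := by
  refine ⟨⟨κ, hk, h0⟩, fun a b z => ⟨k (J'B T a b z), k (J'B T a b z), ?_⟩⟩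
  have hJ := hk _ _ ((Rep.var a).J' (Rep.var b) (Rep.var z))
  exact Rep.eq hB hJ (hJ.J' hJ (hk _ _ (Rep.var z)))
    fun v => El.map_opJ'_of_zero (h0 v) (hbar v) _ _ _

lemma IsTransfer.I (hB : InVariety T B) : IsTransfer T (IB T : B → B) :=
  .of_bar hB (κ := fun _ => El.opI) (fun _ _ h => h.I) (fun _ => rfl)
    fun _ _ _ h => El.opI_eq_zero_of_bar h

lemma IsTransfer.mul_left (hB : InVariety T B) (m : B) : IsTransfer T (fun x => mulB T x m) :=
  .of_bar hB (κ := fun v y => El.mul y (v m)) (fun _ _ h => h.mul (Rep.var m)) (fun _ => rfl)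
    fun _ _ _ h => El.mul_eq_zero_of_bar h _

lemma IsTransfer.mul_right (hB : InVariety T B) (m : B) : IsTransfer T (mulB T m) :=
  .of_opJ' hB (κ := fun v => El.mul (v m)) (fun _ _ h => (Rep.var m).mul h)
    (fun _ => El.mul_zero _) fun _ => El.mul_opJ' _

lemma IsTransfer.mach_left (hB : InVariety T B) (i : Fin T.instr.length) (t : Bool) (m n : B) :
    IsTransfer T (fun x => machB i t x m n) :=
  .of_bar hB (κ := fun v y => El.mach (T.instr.get i) t y (v m) (v n))
    (fun _ _ h => h.mach i t (Rep.var m) (Rep.var n)) (fun _ => El.mach_zero_left ..)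
    fun _ _ _ h => El.mach_left_eq_zero_of_bar h ..

lemma IsTransfer.mach_mid (hB : InVariety T B) (i : Fin T.instr.length) (t : Bool) (m n : B) :
    IsTransfer T (fun x => machB i t m x n) :=
  .of_bar hB (κ := fun v y => El.mach (T.instr.get i) t (v m) y (v n))
    (fun _ _ h => (Rep.var m).mach i t h (Rep.var n)) (fun _ => El.mach_zero_mid ..)
    fun _ _ _ h => El.mach_mid_eq_zero_of_bar h ..

lemma IsTransfer.mach_right (hB : InVariety T B) (i : Fin T.instr.length) (t : Bool)
    (m n : B) : IsTransfer T (machB i t m n) :=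
  .of_opJ' hB (κ := fun v => El.mach (T.instr.get i) t (v m) (v n))
    (fun _ _ h => (Rep.var m).mach i t (Rep.var n) h) (fun _ => El.mach_zero_right ..)
    fun v a b z => El.mach_opJ' (T.instr.get i) t (v m) (v n) a b z

/-- Below every transfer of `t`, no polynomial distinguishes `c` from `d`. -/
def Inseparable (T : TM) {B : Type*} [(Sig T).Structure B] (c d t : B) : Prop :=
  ∀ (g : B → B) (κ : (B → El T) → El T → El T), PolyRep g κ → ∀ k, IsTransfer T k →
    meetB T (g c) (k t) = meetB T (g d) (k t)

namespace Inseparable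

variable {s t x y z : B}

lemma map (ht : Inseparable T c d t) {k : B → B} (hk : IsTransfer T k) :
    Inseparable T c d (k t) :=
  fun g κ hg _ hl => ht g κ hg _ (hl.comp hk)

lemma mono (hB : InVariety T B) (ht : Inseparable T c d t) (hst : leB T s t) :
    Inseparable T c d s := by
  intro g κ hg k hk
  obtain ⟨lam, h₁, h₂⟩ := hk.exists_polyRep
  have key : ∀ u, meetB T u (k (meetB T s t)) =
      meetB T (meetB T u (k t)) (k (meetB T s t)) := fun u => by
    have hm := h₁ _ _ ((Rep.var s).meet (Rep.var t))
    refine Rep.eq hB ((Rep.var u).meet hm)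
      (((Rep.var u).meet (h₁ _ _ (Rep.var t))).meet hm) fun v => ?_
    rcases El.meet_eq_zero_or (v s) (v t) with h | h
    · simp [h, h₂]
    · grind [El.meet, El.meet_self]
  have hst' : meetB T s t = s := hst
  rw [hst'] at key
  rw [key (g c), key (g d), ht g κ hg k hk]

lemma of_leB (hB : InVariety T B) (hdc : leB T d c) : Inseparable T c d d := by
  intro g κ hg k hk
  obtain ⟨lam, h₁, h₂⟩ := hk.exists_polyRep
  have hdc' : meetB T d c = d := hdc
  have hm := (Rep.var (T := T) d).meet (Rep.var c)
  have key : meetB T (g c) (k (meetB T d c)) = meetB T (g (meetB T d c)) (k (meetB T d c)) := by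
    refine Rep.eq hB ((hg _ _ (Rep.var c)).meet (h₁ _ _ hm)) ((hg _ _ hm).meet (h₁ _ _ hm))
      fun v => ?_
    rcases El.meet_eq_zero_or (v d) (v c) with h | h
    · simp [h, h₂]
    · simp [h]
  rwa [hdc'] at key

lemma of_eApp (hB : InVariety T B) (he : ∀ σ : SIdx B, eApp T σ c = eApp T σ d)
    {σ : SIdx B} (ht : eApp T σ t = t) :
    Inseparable T c d t := by
  intro g κ hg k hk
  obtain ⟨lam, h₁, h₂⟩ := hk.exists_polyRep
  obtain ⟨ε, hε, hε'⟩ := exists_polyRep_eApp (T := T) σ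
  have key : ∀ u, meetB T u (k (eApp T σ t)) = meetB T (eApp T σ u) (k (eApp T σ t)) := fun u => by
    have hk' := h₁ _ _ (hε _ _ (Rep.var t))
    refine Rep.eq hB ((Rep.var u).meet hk') ((hε _ _ (Rep.var u)).meet hk') fun v => ?_
    rcases hε' v with h | h <;> simp [h, h₂]
  rw [ht] at key
  rw [key (g c), key (g d), eApp_polynomial_eq hB σ (he σ) hg]

lemma J' (hB : InVariety T B) (he : ∀ σ : SIdx B, eApp T σ c = eApp T σ d)
    (hz : Inseparable T c d z) (a b : B) :
    Inseparable T c d (J'B T a b z) := by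
  intro g κ hg k hk
  obtain ⟨a', b', h⟩ := hk.exists_J' a b z
  have key : ∀ u, meetB T u (J'B T a' b' (k z)) =
      JB T a' (J'B T b' a' (meetB T b' (meetB T (J'B T a' b' (k z)) (meetB T u (k z)))))
        (meetB T (eApp T (.s2 a' b') u) (J'B T a' b' (k z))) := fun u => by
    have ha := Rep.var (T := T) a'
    have hb := Rep.var (T := T) b'
    have hu := Rep.var (T := T) u
    have hk := Rep.var (T := T) (k z)
    have hJ := ha.J' hb hk
    exact Rep.eq hB (hu.meet hJ)
      (ha.J (hb.J' ha (hb.meet (hJ.meet (hu.meet hk)))) ((ha.S2 hb hu hu hu).meet hJ))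
      fun v => El.meet_opJ'_eq ..
  rw [h, key (g c), key (g d), hz g κ hg k hk, eApp_polynomial_eq hB _ (he _) hg]

lemma of_mem (hB : InVariety T B) (he : ∀ σ : SIdx B, eApp T σ c = eApp T σ d)
    (hy : Inseparable T c d y) {φ ψ : (B → El T) → El T}
    (hx : Rep x φ) (hy' : Rep y ψ)
    (h : ∀ v, φ v = El.zero ∨ φ v = ψ v ∨ El.bar (ψ v) = some (φ v)) :
    Inseparable T c d x := by
  rw [show x = J'B T x y y from
    Rep.eq hB hx (hx.J' hy' hy') fun v => El.eq_opJ'_of_mem (h v)]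
  exact hy.J' hB he x y

end Inseparable

/-- If each argument is either unchanged or inseparable, so is the value of a fundamental
operation. -/
lemma funMap_eq_or_inseparable (hB : InVariety T B)
    (he : ∀ σ : SIdx B, eApp T σ c = eApp T σ d) {n : ℕ} (f : (Sig T).Functions n)
    (u w : Fin n → B) (h : ∀ i, u i = w i ∨ Inseparable T c d (w i))
    (hS : ∀ i σ, eApp T σ (u i) = eApp T σ (w i)) :
    Structure.funMap f u = Structure.funMap f w ∨
      Inseparable T c d (Structure.funMap f w) := by
  by_cases huw : u = w
  · exact Or.inl (by rw [huw])
  obtain ⟨i, hui⟩ := Function.ne_iff.1 huw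
  have hi := (h i).resolve_left hui
  have hr (i) := Rep.var (T := T) (w i)
  rw [← FinVec.etaExpand_eq w, ← FinVec.etaExpand_eq u]
  match n, f with
  | 0, _ => exact i.elim0
  | 1, Ops1.I =>
    right
    fin_cases i
    exact hi.map (IsTransfer.I hB)
  | 2, Ops2.meet =>
    right
    have h := (hr 0).meet (hr 1)
    fin_cases i
    · exact hi.mono hB (Rep.eq hB (h.meet (hr 0)) h fun v => by grind [El.meet, El.meet_zero])
    · exact hi.mono hB (Rep.eq hB (h.meet (hr 1)) h fun v => by grind [El.meet, El.meet_zero])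
  | 2, Ops2.mul =>
    right
    fin_cases i
    exacts [hi.map (IsTransfer.mul_left hB (w 1)), hi.map (IsTransfer.mul_right hB (w 0))]
  | 3, Ops3.J =>
    have hJ := (hr 0).J (hr 1) (hr 2)
    rcases h 0 with h0 | h0
    · rcases h 1 with h1 | h1
      · left
        have key : ∀ x y z : B, JB T x y z = JB T x y (eApp T (.s2 x y) z) := fun x y z =>
          have hx := Rep.var x
          have hy := Rep.var y
          have hz := Rep.var z
          Rep.eq hB (hx.J hy hz) (hx.J hy (hx.S2 hy hz hz hz)) fun v => (El.opJ_opS2 ..).symm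
        change JB T (u 0) (u 1) (u 2) = JB T (w 0) (w 1) (w 2)
        rw [key, hS, h0, h1, ← key]
      · exact Or.inr (h1.of_mem hB he hJ (hr 1) fun v => El.opJ_mem ..)
    · exact Or.inr (h0.mono hB (Rep.eq hB (hJ.meet (hr 0)) hJ fun v => by
        grind [El.meet, El.opJ]))
  | 3, Ops3.J' =>
    right
    have h := (hr 0).J' (hr 1) (hr 2)
    fin_cases i
    · exact hi.mono hB (Rep.eq hB (h.meet (hr 0)) h fun v => by grind [El.meet, El.opJ'])
    · exact hi.of_mem hB he h (hr 1) fun v => El.opJ'_mem ..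
    · exact hi.J' hB he (w 0) (w 1)
  | 3, Ops3.K =>
    right
    have h := (hr 0).K (hr 1) (hr 2)
    fin_cases i
    · exact hi.of_mem hB he h (hr 0) fun v => El.opK_mem_left ..
    · exact hi.of_mem hB he h (hr 1) fun v => El.opK_mem_mid ..
    · change Inseparable T c d (KB T (w 0) (w 1) (w 2))
      rw [Rep.eq hB h (h.J' ((hr 1).K (hr 0) (hr 2)) (hr 2)) fun v => El.opK_eq_opJ' ..]
      exact hi.J' hB he _ _
  | 3, Ops3.mach k t =>
    right
    fin_cases i
    exacts [hi.map (IsTransfer.mach_left hB k t (w 1) (w 2)),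
      hi.map (IsTransfer.mach_mid hB k t (w 0) (w 2)),
      hi.map (IsTransfer.mach_right hB k t (w 0) (w 1))]
  | 4, Ops4.S0 =>
    have h := Rep.op4 Ops4.S0 (hr 0) (hr 1) (hr 2) (hr 3)
    exact Or.inr <| .of_eApp hB he (σ := .s0 (w 0)) <|
      Rep.eq hB (Rep.op4 Ops4.S0 (hr 0) h h h) h fun v => El.opS0_opS0 ..
  | 4, Ops4.S1 =>
    have h := Rep.op4 Ops4.S1 (hr 0) (hr 1) (hr 2) (hr 3)
    exact Or.inr <| .of_eApp hB he (σ := .s1 (w 0)) <|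
      Rep.eq hB (Rep.op4 Ops4.S1 (hr 0) h h h) h fun v => El.opS1_opS1 ..
  | 4, Ops4.T =>
    right
    have h := Rep.op4 Ops4.T (hr 0) (hr 1) (hr 2) (hr 3)
    fin_cases i
    · exact (hi.map (IsTransfer.mul_left hB (w 1))).of_mem hB he h ((hr 0).mul (hr 1))
        fun v => El.opT_mem_left ..
    · exact (hi.map (IsTransfer.mul_right hB (w 0))).of_mem hB he h ((hr 0).mul (hr 1))
        fun v => El.opT_mem_left ..
    · exact (hi.map (IsTransfer.mul_left hB (w 3))).of_mem hB he h ((hr 2).mul (hr 3))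
        fun v => El.opT_mem_right ..
    · exact (hi.map (IsTransfer.mul_right hB (w 2))).of_mem hB he h ((hr 2).mul (hr 3))
        fun v => El.opT_mem_right ..
  | 4, Ops4.u1 k t =>
    have h := Rep.op4 (Ops4.u1 k t) (hr 0) (hr 1) (hr 2) (hr 3)
    exact Or.inr <| .of_eApp hB he (σ := .s1 (w 0)) <|
      Rep.eq hB (Rep.op4 Ops4.S1 (hr 0) h h h) h fun v => El.opS1_opU1 ..
  | 4, Ops4.u0 k t =>
    have h := Rep.op4 (Ops4.u0 k t) (hr 0) (hr 1) (hr 2) (hr 3)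
    exact Or.inr <| .of_eApp hB he (σ := .s1 (w 0)) <|
      Rep.eq hB (Rep.op4 Ops4.S1 (hr 0) h h h) h fun v => El.opS1_opU0 ..
  | 5, Ops5.S2 =>
    have h := (hr 0).S2 (hr 1) (hr 2) (hr 3) (hr 4)
    exact Or.inr <| .of_eApp hB he (σ := .s2 (w 0) (w 1)) <|
      Rep.eq hB ((hr 0).S2 (hr 1) h h h) h fun v => El.opS2_opS2 ..
  | _ + 6, f => exact f.elim

lemma polynomial_eq_or_inseparable (hB : InVariety T B) (hdc : leB T d c)
    (he : ∀ σ : SIdx B, eApp T σ c = eApp T σ d) (τ : (Sig T).Term (B ⊕ Unit)) :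
    τ.realize (Sum.elim id fun _ => c) = τ.realize (Sum.elim id fun _ => d) ∨
      Inseparable T c d (τ.realize (Sum.elim id fun _ => d)) := by
  induction τ with
  | var i =>
    rcases i with b | _
    · exact Or.inl rfl
    · exact Or.inr (.of_leB hB hdc)
  | func f ts ih =>
    exact funMap_eq_or_inseparable hB he f _ _ ih fun i σ =>
      eApp_polynomial_eq hB σ (he σ) (PolyRep.of_term (ts i))

/-- Polynomials of algebras in the variety are monotone. -/
lemma polynomial_mono (hB : InVariety T B) (hdc : leB T d c) (τ : (Sig T).Term (B ⊕ Unit)) :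
    leB T (τ.realize (Sum.elim id fun _ => d)) (τ.realize (Sum.elim id fun _ => c)) := by
  have hdc' : meetB T d c = d := hdc
  have hm := (Rep.var (T := T) d).meet (Rep.var c)
  have hτ := PolyRep.of_term τ
  rw [← hdc']
  refine Rep.eq hB ((hτ _ _ hm).meet (hτ _ _ (Rep.var c))) (hτ _ _ hm) fun v =>
    El.meet_eq_left (El.realize_mono τ fun i => ?_)
  rcases i with b | _
  exacts [El.le_refl _, El.meet_le_right _ _]

lemma meetB_self (hB : InVariety T B) (x : B) : meetB T x x = x :=
  Rep.eq hB ((Rep.var x).meet (Rep.var x)) (Rep.var x) fun _ => El.meet_self _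

end Representation

end McKenzie

namespace McKenzie

/-- Let `c, d ∈ B` with `d ≤ c` and `e_i(m̄,c) = e_i(m̄,d)`
for all `i ∈ {0,1,2}` and all `m̄ ∈ B² ∪ B`.  If `f₁, f₂` are unary polynomials
with `r = f₁(c)`, `t = f₁(d) = f₂(c)` and `s = f₂(d)`, then `r = t` or `t = s`
(so decreasing Maltsev chains for `Cg^B(c,d)` have length at most 1). -/
theorem no_long_maltsev_chain (T : TM) (B : Type*) [(Sig T).Structure B]
    (hB : InVariety T B)
    (c d : B) (hdc : leB T d c)
    (he : ∀ σ : SIdx B, eApp T σ c = eApp T σ d)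
    (f₁ f₂ : B → B) (hf₁ : IsPolynomial T f₁) (hf₂ : IsPolynomial T f₂)
    (r t s : B)
    (hr : f₁ c = r) (ht₁ : f₁ d = t) (ht₂ : f₂ c = t) (hs : f₂ d = s) :
    r = t ∨ t = s := by
  obtain ⟨τ₁, hτ₁⟩ := hf₁
  obtain ⟨τ₂, hτ₂⟩ := hf₂
  rcases polynomial_eq_or_inseparable hB hdc he τ₁ with h | h
  · left
    rw [← hr, ← ht₁, hτ₁, hτ₁, h]
  · right
    rw [← hτ₁, ht₁] at h
    have h₁ := h _ _ (PolyRep.of_term τ₂) id .id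
    have h₂ := polynomial_mono hB hdc τ₂
    simp only [← hτ₂, ht₂, hs, id, leB] at h₁ h₂
    rw [← h₂, ← h₁, meetB_self hB]

end McKenzie
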